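/- Let G = ⟨x_1,…,x_d | P_1,…,P_r⟩ be a finitely presented group (P_1,…,P_r words in the free group on x_1,…,x_d) and let F be a field. For each i let Q_i be the noncommutative polynomial in F⟨x_1,…,x_d,y_1,…,y_d⟩ obtained from the word P_i by replacing each occurrence of x_j^{-1} by y_j. Then G is rank-stable over F if and only if the presentation F⟨x_1,…,x_d,y_1,…,y_d⟩/⟨Q_i − 1 (1 ≤ i ≤ r), x_j y_j − 1, y_j x_j − 1 (1 ≤ j ≤ d)⟩ of the group algebra F[G] is rank-stable. -/

import Mathlib

open Matrix

noncomputable section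

/-- Zero-padding of a square matrix to size `m` (the ℕ×ℕ extension `Â`, clipped to size `m`). -/
def padTo {F : Type} [Zero F] {n : ℕ} (m : ℕ) (A : Matrix (Fin n) (Fin n) F) :
    Matrix (Fin m) (Fin m) F :=
  Matrix.of fun i j =>
    if h : (i : ℕ) < n ∧ (j : ℕ) < n then A ⟨i, h.1⟩ ⟨j, h.2⟩ else 0

/-- `Rank(Â − B̂)` for `A ∈ M_n(F)` and `B ∈ M_{n'}(F)`. -/
def padRankDiff {F : Type} [Field F] {n n' : ℕ} (A : Matrix (Fin n) (Fin n) F)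
    (B : Matrix (Fin n') (Fin n') F) : ℕ :=
  (padTo (max n n') A - padTo (max n n') B).rank

/-- Evaluation of a noncommutative polynomial `P ∈ F⟨x_s : s ∈ σ⟩` at a tuple of matrices,
where scalar terms are interpreted as scalar matrices. -/
def evalPoly {F : Type} [Field F] {σ : Type} {n : ℕ}
    (P : FreeAlgebra F σ) (A : σ → Matrix (Fin n) (Fin n) F) :
    Matrix (Fin n) (Fin n) F :=
  FreeAlgebra.lift F A P

/-- Rank-stability of the presentation `F⟨x_s : s ∈ σ⟩ / ⟨P_i : i ∈ ι⟩`. -/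
def RankStable (F : Type) [Field F] {σ ι : Type} (P : ι → FreeAlgebra F σ) : Prop :=
  ∀ ε : ℝ, 0 < ε → ∃ δ : ℝ, 0 < δ ∧
    ∀ n : ℕ, 0 < n → ∀ A : σ → Matrix (Fin n) (Fin n) F,
      (∀ i, ((evalPoly (P i) A).rank : ℝ) < δ * n) →
      ∃ n' : ℕ, 0 < n' ∧ ∃ B : σ → Matrix (Fin n') (Fin n') F,
        (∀ i, evalPoly (P i) B = 0) ∧
        ∀ j, ((padRankDiff (A j) (B j) : ℝ) < ε * n)

/-- Rank-stability of a finitely presented group over the field `F`. -/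
def GroupRankStable (F : Type) [Field F] {d r : ℕ} (P : Fin r → FreeGroup (Fin d)) : Prop :=
  ∀ ε : ℝ, 0 < ε → ∃ δ : ℝ, 0 < δ ∧
    ∀ n : ℕ, 0 < n → ∀ A : Fin d → GL (Fin n) F,
      (∀ j, ((((FreeGroup.lift A (P j) : GL (Fin n) F) : Matrix (Fin n) (Fin n) F)
          - 1).rank : ℝ) < δ * n) →
      ∃ n' : ℕ, 0 < n' ∧ ∃ B : Fin d → GL (Fin n') F,
        (∀ j, FreeGroup.lift B (P j) = 1) ∧
        ∀ i, ((padRankDiff ((A i : Matrix (Fin n) (Fin n) F))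
            ((B i : Matrix (Fin n') (Fin n') F)) : ℝ) < ε * n)

/-- The noncommutative polynomial in `F⟨x_1,…,x_d,y_1,…,y_d⟩` obtained from a word in the
free group on `x_1,…,x_d` by replacing each occurrence of `x_j⁻¹` by `y_j`
(`inl` indexes the `x`'s, `inr` the `y`'s). -/
def wordToPoly (F : Type) [Field F] {d : ℕ} (w : FreeGroup (Fin d)) :
    FreeAlgebra F (Fin d ⊕ Fin d) :=
  (w.toWord.map fun p =>
    if p.2 then FreeAlgebra.ι F (Sum.inl p.1) else FreeAlgebra.ι F (Sum.inr p.1)).prod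

/-- The relations of the presentation of the group algebra `F[G]` associated to a group
presentation `G = ⟨x_1,…,x_d ∣ P_1,…,P_r⟩`. -/
def groupAlgebraRels (F : Type) [Field F] {d r : ℕ} (P : Fin r → FreeGroup (Fin d)) :
    (Fin r ⊕ (Fin d ⊕ Fin d)) → FreeAlgebra F (Fin d ⊕ Fin d) :=
  Sum.elim (fun i => wordToPoly F (P i) - 1)
    (Sum.elim
      (fun j => FreeAlgebra.ι F (Sum.inl j) * FreeAlgebra.ι F (Sum.inr j) - 1)
      (fun j => FreeAlgebra.ι F (Sum.inr j) * FreeAlgebra.ι F (Sum.inl j) - 1))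

theorem Matrix.rank_add_le_add {F m n : Type*} [Field F] [Fintype m] [Fintype n]
    (A B : Matrix m n F) : (A + B).rank ≤ A.rank + B.rank := by
  classical
  have h : LinearMap.range (A + B).mulVecLin ≤
      LinearMap.range A.mulVecLin ⊔ LinearMap.range B.mulVecLin := by
    rintro _ ⟨v, rfl⟩
    rw [Matrix.mulVecLin_add]
    exact Submodule.add_mem_sup ⟨v, rfl⟩ ⟨v, rfl⟩
  exact (Submodule.finrank_mono h).trans (Submodule.finrank_add_le_finrank_add_finrank _ _)

theorem Matrix.rank_neg_eq {F m n : Type*} [Field F] [Fintype m] [Fintype n]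
    (A : Matrix m n F) : (-A).rank = A.rank := by
  rw [← neg_one_smul F A]
  exact Matrix.rank_smul_of_mem_nonZeroDivisors A (by simp)

theorem Matrix.rank_sub_comm {F m n : Type*} [Field F] [Fintype m] [Fintype n]
    (A B : Matrix m n F) : (A - B).rank = (B - A).rank := by
  rw [← Matrix.rank_neg_eq, neg_sub]

theorem Matrix.rank_sub_le_add {F m n : Type*} [Field F] [Fintype m] [Fintype n]
    (A B : Matrix m n F) : (A - B).rank ≤ A.rank + B.rank := by
  rw [sub_eq_add_neg, ← Matrix.rank_neg_eq B]
  exact Matrix.rank_add_le_add _ _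

theorem Matrix.rank_sub_le_rank_sub_add_rank_sub {F m n : Type*} [Field F] [Fintype m] [Fintype n]
    (A B C : Matrix m n F) : (A - C).rank ≤ (A - B).rank + (B - C).rank := by
  rw [← sub_add_sub_cancel A B C]
  exact Matrix.rank_add_le_add _ _

/-- An idempotent and its complement have ranks adding up to at most the size. -/
theorem Matrix.rank_one_sub_add_rank_le {F n : Type*} [Field F] [Fintype n] [DecidableEq n]
    {E : Matrix n n F} (hE : E * E = E) : (1 - E).rank + E.rank ≤ Fintype.card n :=
  Matrix.rank_add_rank_le_card_of_mul_eq_zero (by rw [sub_mul, one_mul, hE, sub_self])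

/-- Every square matrix becomes invertible after a perturbation of rank at most its corank. -/
theorem Matrix.exists_unit_rank_sub_add_rank_le {F n : Type*} [Field F] [Fintype n] [DecidableEq n]
    (M : Matrix n n F) :
    ∃ U : (Matrix n n F)ˣ, (M - U).rank + M.rank ≤ Fintype.card n := by
  obtain ⟨V, W, e, ⟨V, rfl⟩, ⟨W, rfl⟩, h⟩ := Matrix.exists_rank_normal_form M
  set E : Matrix n n F := (Matrix.fromBlocks 1 0 0 0).submatrix e e with hE
  have hEE : E * E = E := by
    rw [hE, Matrix.submatrix_mul_equiv, Matrix.fromBlocks_multiply]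
    simp
  have hM : M = (↑V⁻¹ : Matrix n n F) * E * (↑W⁻¹ : Matrix n n F) := by
    rw [← h, mul_assoc _ _ (W : Matrix n n F), Units.inv_mul_cancel_left,
      Units.mul_inv_cancel_right]
  refine ⟨V⁻¹ * W⁻¹, ?_⟩
  have h1 : (M - ↑(V⁻¹ * W⁻¹)).rank ≤ (1 - E).rank := by
    have : M - ↑(V⁻¹ * W⁻¹) = (↑V⁻¹ : Matrix n n F) * (E - 1) * (↑W⁻¹ : Matrix n n F) := by
      rw [hM, mul_sub, sub_mul, mul_one, Units.val_mul]
    rw [this, Matrix.rank_sub_comm 1 E]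
    exact (Matrix.rank_mul_le_left _ _).trans (Matrix.rank_mul_le_right _ _)
  have h2 : M.rank ≤ E.rank := by
    conv_lhs => rw [hM]
    exact (Matrix.rank_mul_le_left _ _).trans (Matrix.rank_mul_le_right _ _)
  have h3 := Matrix.rank_one_sub_add_rank_le hEE
  omega

theorem Matrix.rank_list_prod_map_sub_le {F n α : Type*} [Field F] [Fintype n] [DecidableEq n]
    {f g : α → Matrix n n F} {k : ℕ} (h : ∀ a, (f a - g a).rank ≤ k) (l : List α) :
    ((l.map f).prod - (l.map g).prod).rank ≤ l.length * k := by
  induction l with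
  | nil => simp
  | cons a l ih =>
    have e : (List.map f (a :: l)).prod - (List.map g (a :: l)).prod =
        (f a - g a) * (l.map f).prod + g a * ((l.map f).prod - (l.map g).prod) := by
      simp only [List.map_cons, List.prod_cons]
      noncomm_ring
    rw [e, List.length_cons, add_mul, one_mul, add_comm _ k]
    exact (Matrix.rank_add_le_add _ _).trans (add_le_add
      ((Matrix.rank_mul_le_left _ _).trans (h a)) ((Matrix.rank_mul_le_right _ _).trans ih))

/-- The inclusion of the first `n` coordinates into the first `m` coordinates. -/
def padIncl (F : Type) [Field F] (m n : ℕ) : Matrix (Fin m) (Fin n) F :=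
  Matrix.of fun i j => if (i : ℕ) = j then 1 else 0

theorem padTo_eq_mul {F : Type} [Field F] {m n : ℕ} (A : Matrix (Fin n) (Fin n) F) :
    padTo m A = padIncl F m n * A * (padIncl F m n)ᵀ := by
  have key (i : Fin m) (g : Fin n → F) : ∑ x : Fin n, (if (i : ℕ) = x then g x else 0) =
      if h : (i : ℕ) < n then g ⟨i, h⟩ else 0 := by
    split_ifs with h
    · rw [Finset.sum_eq_single (⟨i, h⟩ : Fin n)]
      · simp
      · intro b _ hb
        rw [if_neg fun h' => hb (Fin.ext h'.symm)]
      · simp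
    · exact Finset.sum_eq_zero fun x _ => if_neg fun h' => h (by omega)
  ext i j
  simp only [padTo, padIncl, Matrix.mul_apply, Matrix.of_apply, Matrix.transpose_apply, ite_mul,
    mul_ite, one_mul, mul_one, zero_mul, mul_zero, key]
  by_cases hi : (i : ℕ) < n <;> by_cases hj : (j : ℕ) < n <;> simp [hi, hj]

theorem padIncl_transpose_mul_self {F : Type} [Field F] {m n : ℕ} (h : n ≤ m) :
    (padIncl F m n)ᵀ * padIncl F m n = 1 := by
  ext i j
  simp only [padIncl, Matrix.mul_apply, Matrix.of_apply, Matrix.transpose_apply, ite_mul,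
    one_mul, zero_mul]
  rw [Finset.sum_eq_single (⟨i, i.isLt.trans_le h⟩ : Fin m)]
  · simp [Matrix.one_apply, Fin.ext_iff]
  · intro b _ hb
    rw [if_neg fun h' => hb (Fin.ext h')]
  · simp

theorem padTo_sub {F : Type} [Field F] {m n : ℕ} (A B : Matrix (Fin n) (Fin n) F) :
    padTo m A - padTo m B = padTo m (A - B) := by
  simp only [padTo_eq_mul, Matrix.mul_sub, Matrix.sub_mul]

theorem padTo_mul_padTo {F : Type} [Field F] {m n : ℕ} (h : n ≤ m)
    (A B : Matrix (Fin n) (Fin n) F) : padTo m A * padTo m B = padTo m (A * B) := by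
  simp only [padTo_eq_mul, Matrix.mul_assoc]
  rw [← Matrix.mul_assoc (padIncl F m n)ᵀ, padIncl_transpose_mul_self h, Matrix.one_mul]

theorem rank_padTo_le {F : Type} [Field F] {m n : ℕ} (A : Matrix (Fin n) (Fin n) F) :
    (padTo m A).rank ≤ A.rank := by
  rw [padTo_eq_mul]
  exact (Matrix.rank_mul_le_left _ _).trans (Matrix.rank_mul_le_right _ _)

theorem rank_padTo {F : Type} [Field F] {m n : ℕ} (h : n ≤ m) (A : Matrix (Fin n) (Fin n) F) :
    (padTo m A).rank = A.rank := by
  refine le_antisymm (rank_padTo_le A) ?_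
  have e : A = (padIncl F m n)ᵀ * padTo m A * padIncl F m n := by
    rw [padTo_eq_mul, ← Matrix.mul_assoc, ← Matrix.mul_assoc, padIncl_transpose_mul_self h,
      Matrix.one_mul, Matrix.mul_assoc, padIncl_transpose_mul_self h, Matrix.mul_one]
  conv_lhs => rw [e]
  exact (Matrix.rank_mul_le_left _ _).trans (Matrix.rank_mul_le_right _ _)

theorem rank_one_sub_padTo_one_add_le {F : Type} [Field F] {m n : ℕ} (h : n ≤ m) :
    (1 - padTo m (1 : Matrix (Fin n) (Fin n) F)).rank + n ≤ m := by
  simpa [rank_padTo h] using Matrix.rank_one_sub_add_rank_le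
    (E := padTo m (1 : Matrix (Fin n) (Fin n) F)) (by rw [padTo_mul_padTo h, mul_one])

theorem padRankDiff_le_add {F : Type} [Field F] {n n' : ℕ} (A B : Matrix (Fin n) (Fin n) F)
    (C : Matrix (Fin n') (Fin n') F) : padRankDiff A C ≤ (A - B).rank + padRankDiff B C := by
  refine (Matrix.rank_sub_le_rank_sub_add_rank_sub _
    (padTo (max n n') B) _).trans (Nat.add_le_add_right ?_ _)
  rw [padTo_sub]
  exact rank_padTo_le _

/-- Passing to inverses at most doubles the rank distance between invertible matrices, even of
different sizes. -/
theorem padRankDiff_inv_le {F : Type} [Field F] {n n' : ℕ} (A : GL (Fin n) F) (B : GL (Fin n') F) :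
    padRankDiff (↑A⁻¹ : Matrix (Fin n) (Fin n) F) (↑B⁻¹ : Matrix (Fin n') (Fin n') F) ≤
      2 * padRankDiff (A : Matrix (Fin n) (Fin n) F) (B : Matrix (Fin n') (Fin n') F) := by
  unfold padRankDiff
  have hn : n ≤ max n n' := le_max_left _ _
  have hn' : n' ≤ max n n' := le_max_right _ _
  have hm : max n n' = n ∨ max n n' = n' := (max_choice n n')
  generalize max n n' = m at hn hn' hm ⊢
  set a := padTo m (A : Matrix (Fin n) (Fin n) F) with ha
  set b := padTo m (B : Matrix (Fin n') (Fin n') F) with hb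
  set a' := padTo m (↑A⁻¹ : Matrix (Fin n) (Fin n) F) with ha'
  set b' := padTo m (↑B⁻¹ : Matrix (Fin n') (Fin n') F) with hb'
  have haa : a' * a = padTo m (1 : Matrix (Fin n) (Fin n) F) := by
    rw [ha, ha', padTo_mul_padTo hn, Units.inv_mul]
  have hbb : b * b' = padTo m (1 : Matrix (Fin n') (Fin n') F) := by
    rw [hb, hb', padTo_mul_padTo hn', Units.mul_inv]
  have e : a' - b' = a' * (b - a) * b' +
      (a' * (1 - padTo m (1 : Matrix (Fin n') (Fin n') F)) -
        (1 - padTo m (1 : Matrix (Fin n) (Fin n) F)) * b') := by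
    rw [← haa, ← hbb]
    noncomm_ring
  have h1 : (a' * (b - a) * b').rank ≤ (a - b).rank := by
    rw [Matrix.rank_sub_comm a b]
    exact (Matrix.rank_mul_le_left _ _).trans (Matrix.rank_mul_le_right _ _)
  have h2 := Matrix.rank_add_le_add (a' * (b - a) * b')
      (a' * (1 - padTo m (1 : Matrix (Fin n') (Fin n') F)) -
        (1 - padTo m (1 : Matrix (Fin n) (Fin n) F)) * b')
  have h3 := Matrix.rank_sub_le_add (a' * (1 - padTo m (1 : Matrix (Fin n') (Fin n') F)))
        ((1 - padTo m (1 : Matrix (Fin n) (Fin n) F)) * b')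
  have h4 := Matrix.rank_mul_le_right a' (1 - padTo m (1 : Matrix (Fin n') (Fin n') F))
  have h5 := Matrix.rank_mul_le_left (1 - padTo m (1 : Matrix (Fin n) (Fin n) F)) b'
  have h6 := rank_one_sub_padTo_one_add_le (F := F) hn
  have h7 := rank_one_sub_padTo_one_add_le (F := F) hn'
  have hra : a.rank = n := by rw [ha, rank_padTo hn, Matrix.rank_unit, Fintype.card_fin]
  have hrb : b.rank = n' := by rw [hb, rank_padTo hn', Matrix.rank_unit, Fintype.card_fin]
  have h8 := Matrix.rank_sub_le_rank_sub_add_rank_sub a b 0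
  have h9 := Matrix.rank_sub_le_rank_sub_add_rank_sub b a 0
  rw [Matrix.rank_sub_comm b a] at h9
  simp only [sub_zero] at h8 h9
  rw [← e] at h2
  omega

theorem evalPoly_wordToPoly {F : Type} [Field F] {d n : ℕ} (w : FreeGroup (Fin d))
    (A : Fin d ⊕ Fin d → Matrix (Fin n) (Fin n) F) :
    evalPoly (wordToPoly F w) A =
      (w.toWord.map fun p => if p.2 then A (Sum.inl p.1) else A (Sum.inr p.1)).prod := by
  unfold evalPoly wordToPoly
  rw [map_list_prod, List.map_map]
  congr 2
  funext p
  simp only [Function.comp_apply]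
  split_ifs <;> simp

theorem evalPoly_wordToPoly_units {F : Type} [Field F] {d n : ℕ} (w : FreeGroup (Fin d))
    (A : Fin d → GL (Fin n) F) :
    evalPoly (wordToPoly F w) (Sum.elim (fun j => (A j : Matrix (Fin n) (Fin n) F))
      fun j => (↑(A j)⁻¹ : Matrix (Fin n) (Fin n) F)) =
      (FreeGroup.lift A w : GL (Fin n) F) := by
  rw [evalPoly_wordToPoly]
  conv_rhs => rw [← FreeGroup.mk_toWord (x := w), FreeGroup.lift_mk]
  rw [← Units.coeHom_apply, map_list_prod, List.map_map]
  congr 2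
  funext p
  rcases p with ⟨i, _ | _⟩ <;> simp

theorem evalPoly_groupAlgebraRels_word {F : Type} [Field F] {d r n : ℕ}
    (P : Fin r → FreeGroup (Fin d)) (A : Fin d ⊕ Fin d → Matrix (Fin n) (Fin n) F) (i : Fin r) :
    evalPoly (groupAlgebraRels F P (Sum.inl i)) A = evalPoly (wordToPoly F (P i)) A - 1 := by
  simp [groupAlgebraRels, evalPoly]

theorem evalPoly_groupAlgebraRels_mul_inv {F : Type} [Field F] {d r n : ℕ}
    (P : Fin r → FreeGroup (Fin d)) (A : Fin d ⊕ Fin d → Matrix (Fin n) (Fin n) F) (j : Fin d) :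
    evalPoly (groupAlgebraRels F P (Sum.inr (Sum.inl j))) A =
      A (Sum.inl j) * A (Sum.inr j) - 1 := by
  simp [groupAlgebraRels, evalPoly]

theorem evalPoly_groupAlgebraRels_inv_mul {F : Type} [Field F] {d r n : ℕ}
    (P : Fin r → FreeGroup (Fin d)) (A : Fin d ⊕ Fin d → Matrix (Fin n) (Fin n) F) (j : Fin d) :
    evalPoly (groupAlgebraRels F P (Sum.inr (Sum.inr j))) A =
      A (Sum.inr j) * A (Sum.inl j) - 1 := by
  simp [groupAlgebraRels, evalPoly]

theorem evalPoly_groupAlgebraRels_units {F : Type} [Field F] {d r n : ℕ}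
    (P : Fin r → FreeGroup (Fin d)) (A : Fin d → GL (Fin n) F) (i : Fin r ⊕ (Fin d ⊕ Fin d)) :
    evalPoly (groupAlgebraRels F P i) (Sum.elim (fun j => (A j : Matrix (Fin n) (Fin n) F))
      fun j => (↑(A j)⁻¹ : Matrix (Fin n) (Fin n) F)) =
      Sum.elim (fun i => ((FreeGroup.lift A (P i) : GL (Fin n) F) : Matrix (Fin n) (Fin n) F) - 1)
        (fun _ => 0) i := by
  rcases i with i | j | j
  · rw [evalPoly_groupAlgebraRels_word, evalPoly_wordToPoly_units, Sum.elim_inl]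
  · simp only [evalPoly_groupAlgebraRels_mul_inv, Sum.elim_inl, Sum.elim_inr, Units.mul_inv,
      sub_self]
  · simp only [evalPoly_groupAlgebraRels_inv_mul, Sum.elim_inl, Sum.elim_inr, Units.inv_mul,
      sub_self]

/-- An almost inverse pair of matrices is close to an exactly inverse one. -/
theorem Matrix.exists_unit_near_of_almost_inverse {F n : Type*} [Field F] [Fintype n]
    [DecidableEq n] (X Y : Matrix n n F) :
    ∃ U : (Matrix n n F)ˣ, (X - U).rank ≤ (X * Y - 1).rank ∧
      (Y - ↑U⁻¹).rank ≤ 2 * (X * Y - 1).rank := by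
  obtain ⟨U, hU⟩ := Matrix.exists_unit_rank_sub_add_rank_le X
  have h1 : Fintype.card n ≤ (X * Y).rank + (X * Y - 1).rank := by
    have := Matrix.rank_sub_le_add (X * Y) (X * Y - 1)
    rwa [sub_sub_cancel, Matrix.rank_one] at this
  have h2 := Matrix.rank_mul_le_left X Y
  have hX : (X - U).rank ≤ (X * Y - 1).rank := by omega
  refine ⟨U, hX, ?_⟩
  have e : Y - ↑U⁻¹ = (↑U⁻¹ : Matrix n n F) * ((X * Y - 1) - (X - (U : Matrix n n F)) * Y) := by
    have : (X * Y - 1) - (X - (U : Matrix n n F)) * Y = U * Y - 1 := by noncomm_ring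
    rw [this, mul_sub, Units.inv_mul_cancel_left, mul_one]
  have h3 := Matrix.rank_mul_le_right (↑U⁻¹ : Matrix n n F) ((X * Y - 1) - (X - (U : Matrix n n F)) * Y)
  have h4 := Matrix.rank_sub_le_add (X * Y - 1) ((X - (U : Matrix n n F)) * Y)
  have h5 := Matrix.rank_mul_le_left (X - (U : Matrix n n F)) Y
  rw [e]
  omega

theorem RankStable.groupRankStable {F : Type} [Field F] {d r : ℕ} {P : Fin r → FreeGroup (Fin d)}
    (h : RankStable F (groupAlgebraRels F P)) : GroupRankStable F P := by
  intro ε hε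
  obtain ⟨δ, hδ, H⟩ := h ε hε
  refine ⟨δ, hδ, fun n hn A hA => ?_⟩
  obtain ⟨n', hn', B, hB, hAB⟩ := H n hn
    (Sum.elim (fun j => (A j : Matrix (Fin n) (Fin n) F))
      fun j => (↑(A j)⁻¹ : Matrix (Fin n) (Fin n) F)) (by
    intro i
    rw [evalPoly_groupAlgebraRels_units]
    rcases i with i | j
    · exact hA i
    · simp only [Sum.elim_inr, Matrix.rank_zero, Nat.cast_zero]
      positivity)
  have hxy (j : Fin d) : B (Sum.inl j) * B (Sum.inr j) = 1 := by
    simpa only [evalPoly_groupAlgebraRels_mul_inv, sub_eq_zero] using hB (Sum.inr (Sum.inl j))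
  have hyx (j : Fin d) : B (Sum.inr j) * B (Sum.inl j) = 1 := by
    simpa only [evalPoly_groupAlgebraRels_inv_mul, sub_eq_zero] using hB (Sum.inr (Sum.inr j))
  let U (j : Fin d) : GL (Fin n') F := ⟨_, _, hxy j, hyx j⟩
  have hU : B = Sum.elim (fun j => (U j : Matrix (Fin n') (Fin n') F))
      fun j => (↑(U j)⁻¹ : Matrix (Fin n') (Fin n') F) := by
    funext s
    rcases s with j | j <;> rfl
  refine ⟨n', hn', U, fun i => ?_, fun j => hAB (Sum.inl j)⟩
  have := hB (Sum.inl i)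
  rw [hU, evalPoly_groupAlgebraRels_units, Sum.elim_inl, sub_eq_zero] at this
  exact Units.ext this

theorem GroupRankStable.rankStable {F : Type} [Field F] {d r : ℕ} {P : Fin r → FreeGroup (Fin d)}
    (h : GroupRankStable F P) : RankStable F (groupAlgebraRels F P) := by
  intro ε hε
  obtain ⟨δ, hδ, H⟩ := h (ε / 4) (by positivity)
  set L : ℕ := ∑ i, (P i).toWord.length
  have hpos : (0 : ℝ) < 2 * L + 1 := by positivity
  refine ⟨min (ε / 8) (δ / (2 * L + 1)), by positivity, fun n hn A hA => ?_⟩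
  have hn0 : (0 : ℝ) < n := Nat.cast_pos.2 hn
  set η := min (ε / 8) (δ / (2 * L + 1))
  have hηε : η * n ≤ ε / 8 * n := by gcongr; exact min_le_left _ _
  have hηδ : (2 * L + 1) * (η * n) ≤ δ * n := by
    rw [← mul_assoc]
    gcongr
    rw [← le_div_iff₀' hpos]
    exact min_le_right _ _
  choose U hUX hUY using fun j : Fin d =>
    Matrix.exists_unit_near_of_almost_inverse (A (Sum.inl j)) (A (Sum.inr j))
  have hdef (j : Fin d) : ((A (Sum.inl j) * A (Sum.inr j) - 1).rank : ℝ) < η * n := by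
    simpa only [evalPoly_groupAlgebraRels_mul_inv] using hA (Sum.inr (Sum.inl j))
  have hX (j : Fin d) :
      ((A (Sum.inl j) - (U j : Matrix (Fin n) (Fin n) F)).rank : ℝ) < η * n :=
    (Nat.cast_le.2 (hUX j)).trans_lt (hdef j)
  have hY (j : Fin d) :
      ((A (Sum.inr j) - (↑(U j)⁻¹ : Matrix (Fin n) (Fin n) F)).rank : ℝ) < 2 * (η * n) := by
    have : ((A (Sum.inr j) - (↑(U j)⁻¹ : Matrix (Fin n) (Fin n) F)).rank : ℝ) ≤
        2 * (A (Sum.inl j) * A (Sum.inr j) - 1).rank := by exact_mod_cast hUY j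
    linarith [hdef j]
  have hword (i : Fin r) : ((((FreeGroup.lift U (P i) : GL (Fin n) F) :
      Matrix (Fin n) (Fin n) F) - 1).rank : ℝ) < δ * n := by
    have hη0 : 0 ≤ 2 * (η * n) := by positivity
    have h1 := Matrix.rank_list_prod_map_sub_le (k := ⌊2 * (η * n)⌋₊)
      (f := fun p : Fin d × Bool => if p.2 then
        (U p.1 : Matrix (Fin n) (Fin n) F) else (↑(U p.1)⁻¹ : Matrix (Fin n) (Fin n) F))
      (g := fun p => if p.2 then A (Sum.inl p.1) else A (Sum.inr p.1))
      (by
        rintro ⟨j, _ | _⟩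
        · simpa [Matrix.rank_sub_comm _ (A _)] using Nat.le_floor (hY j).le
        · simpa [Matrix.rank_sub_comm _ (A _)] using
            Nat.le_floor ((hX j).le.trans (by linarith)))
      (P i).toWord
    have h2 := evalPoly_wordToPoly_units (P i) U
    rw [evalPoly_wordToPoly] at h2
    simp only [Sum.elim_inl, Sum.elim_inr] at h2
    rw [h2, ← evalPoly_wordToPoly] at h1
    have h3 := hA (Sum.inl i)
    rw [evalPoly_groupAlgebraRels_word] at h3
    have h4 : ((((FreeGroup.lift U (P i) : GL (Fin n) F) :
        Matrix (Fin n) (Fin n) F) - 1).rank : ℝ) ≤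
        (P i).toWord.length * ⌊2 * (η * n)⌋₊ + (evalPoly (wordToPoly F (P i)) A - 1).rank := by
      exact_mod_cast (Matrix.rank_sub_le_rank_sub_add_rank_sub _
        (evalPoly (wordToPoly F (P i)) A) _).trans (Nat.add_le_add_right h1 _)
    have h5 : ((P i).toWord.length : ℝ) ≤ L := Nat.cast_le.2
      (Finset.single_le_sum (f := fun i => (P i).toWord.length) (fun _ _ => Nat.zero_le _)
        (Finset.mem_univ i))
    have h6 : ((P i).toWord.length : ℝ) * ⌊2 * (η * n)⌋₊ ≤ L * (2 * (η * n)) := by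
      gcongr
      exact Nat.floor_le hη0
    linarith
  obtain ⟨n', hn', B, hB, hUB⟩ := H n hn U hword
  refine ⟨n', hn', Sum.elim (fun j => (B j : Matrix (Fin n') (Fin n') F))
    fun j => (↑(B j)⁻¹ : Matrix (Fin n') (Fin n') F), fun i => ?_, fun s => ?_⟩
  · rw [evalPoly_groupAlgebraRels_units]
    rcases i with i | j
    · simp [hB]
    · rfl
  · rcases s with j | j
    · have h1 : (padRankDiff (A (Sum.inl j)) (B j : Matrix (Fin n') (Fin n') F) : ℝ) ≤ _ :=
        Nat.cast_le.2 (padRankDiff_le_add _ (U j : Matrix (Fin n) (Fin n) F) _)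
      rw [Nat.cast_add] at h1
      simp only [Sum.elim_inl]
      nlinarith [hX j, hUB j]
    · have h1 : (padRankDiff (A (Sum.inr j)) (↑(B j)⁻¹ : Matrix (Fin n') (Fin n') F) : ℝ) ≤ _ :=
        Nat.cast_le.2 ((padRankDiff_le_add _ (↑(U j)⁻¹ : Matrix (Fin n) (Fin n) F) _).trans
          (Nat.add_le_add_left (padRankDiff_inv_le (U j) (B j)) _))
      simp only [Nat.cast_add, Nat.cast_mul, Nat.cast_ofNat] at h1
      simp only [Sum.elim_inr]
      nlinarith [hY j, hUB j]

/-- **Group stability vs. group algebra stability.** A finitely presented group `G` is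
rank-stable over `F` if and only if the associated presentation of its group algebra
`F[G]` is rank-stable. -/
theorem stmt2_group_rank_stable_iff_group_algebra_rank_stable
    (F : Type) [Field F] (d r : ℕ) (P : Fin r → FreeGroup (Fin d)) :
    GroupRankStable F P ↔ RankStable F (groupAlgebraRels F P) :=
  ⟨GroupRankStable.rankStable, RankStable.groupRankStable⟩
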